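/- Suppose ξ has span 1. Then there exist constants β, δ > 0 and c₁ > 0 such that F extends to an analytic function on Δ(β, δ) and for all z ∈ Δ(β, δ), |1 − z Φ'(F(z))| ≥ c₁ |1 − z|^{1/2}. -/

import Mathlib

open scoped ENNReal BigOperators
open Set Filter

/-- Plane (ordered rooted) trees. -/
inductive PlaneTree : Type
  | node : List PlaneTree → PlaneTree

namespace PlaneTree

/-- The list of subtrees hanging off the root. -/
def children : PlaneTree → List PlaneTree
  | .node ts => ts

/-- The subtree rooted at a given position (sequence of child indices), if it exists. -/
def subtreeAt : PlaneTree → List ℕ → Option PlaneTree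
  | t, [] => some t
  | .node ts, i :: q =>
    match ts[i]? with
    | some t' => subtreeAt t' q
    | none => none

/-- The vertex set of a tree, with vertices identified with their positions. -/
def vertexSet (t : PlaneTree) : Set (List ℕ) := {q | (subtreeAt t q).isSome}

/-- The number of vertices of a tree. -/
noncomputable def size (t : PlaneTree) : ℕ := (vertexSet t).ncard

/-- The number of children of the vertex at position `q`. -/
def childCount (t : PlaneTree) (q : List ℕ) : ℕ :=
  ((subtreeAt t q).map fun t' => t'.children.length).getD 0

end PlaneTree

/-- Longest common prefix of two positions; this is the position of the last common
ancestor of the two vertices. -/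
def lca : List ℕ → List ℕ → List ℕ
  | a :: as, b :: bs => if a = b then a :: lca as bs else []
  | _, _ => []

/-- The distance from `v` up to the last common ancestor of `v` and `w`. -/
def dUp (v w : List ℕ) : ℕ := v.length - (lca v w).length

/-- The graph distance between the vertices at positions `v` and `w`. -/
def treeDist (v w : List ℕ) : ℕ := dUp v w + dUp w v

/-- The Galton–Watson probability of a given finite tree: the product, over all vertices,
of the probability that the offspring distribution takes the value given by the number of
children of the vertex. -/
noncomputable def gwProb (p : ℕ → ℝ≥0∞) (t : PlaneTree) : ℝ≥0∞ :=
  ∏ᶠ v ∈ PlaneTree.vertexSet t, p (PlaneTree.childCount t v)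

/-- `P(|𝒯| = n)` for the Galton–Watson tree `𝒯`. -/
noncomputable def probSize (p : ℕ → ℝ≥0∞) (n : ℕ) : ℝ≥0∞ :=
  ∑' t : PlaneTree, if PlaneTree.size t = n then gwProb p t else 0

/-- `E f(T_n)` where `T_n` is the Galton–Watson tree conditioned to have `n` vertices. -/
noncomputable def condExp (p : ℕ → ℝ≥0∞) (n : ℕ) (f : PlaneTree → ℝ≥0∞) : ℝ≥0∞ :=
  (∑' t : PlaneTree, if PlaneTree.size t = n then gwProb p t * f t else 0) / probSize p n

/-- The variance of the offspring distribution `p` (which has mean `1`). -/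
noncomputable def xiVar (p : ℕ → ℝ≥0∞) : ℝ≥0∞ :=
  ∑' k : ℕ, p k * ENNReal.ofReal (((k : ℝ) - 1) ^ 2)

/-- `P_k(t)`: the number of unordered pairs of vertices of `t` at graph distance `k`. -/
noncomputable def pairCount (t : PlaneTree) (k : ℕ) : ℕ :=
  {s : Set (List ℕ) | ∃ v w, v ∈ PlaneTree.vertexSet t ∧ w ∈ PlaneTree.vertexSet t ∧
    s = {v, w} ∧ treeDist v w = k}.ncard

/-- The singularity-analysis domain `Δ(β, δ)`. -/
def Delta (β δ : ℝ) : Set ℂ :=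
  {z : ℂ | ‖z‖ < 1 + δ ∧ z ≠ 1 ∧ Real.pi / 2 - β < |Complex.arg (z - 1)|}

/-- `F(z) = E z^{|𝒯|}`, the probability generating function of the total progeny. -/
noncomputable def Fgen (p : ℕ → ℝ≥0∞) (z : ℂ) : ℂ :=
  ∑' t : PlaneTree, ((gwProb p t).toReal : ℂ) * z ^ PlaneTree.size t

/-- `Φ'(w)`, the derivative of the probability generating function `Φ(w) = E w^ξ` of the
offspring distribution. -/
noncomputable def PhiDeriv (p : ℕ → ℝ≥0∞) (w : ℂ) : ℂ :=
  ∑' k : ℕ, (k : ℂ) * ((p k).toReal : ℂ) * w ^ (k - 1)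

namespace PlaneTree

theorem vertexSet_node (ts : List PlaneTree) :
    vertexSet (node ts) =
      insert [] (⋃ i : Fin ts.length, List.cons (i : ℕ) '' vertexSet (ts.get i)) := by
  ext q
  cases q with
  | nil => simp [vertexSet, subtreeAt]
  | cons j q =>
    by_cases hj : j < ts.length
    · simp only [vertexSet, subtreeAt, mem_ofPred_eq, List.getElem?_eq_getElem hj, mem_insert_iff,
        reduceCtorEq, mem_iUnion, mem_image, List.cons.injEq, false_or, List.get_eq_getElem]
      constructor
      · intro h
        exact ⟨⟨j, hj⟩, q, h, rfl, rfl⟩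
      · rintro ⟨i, q', h, rfl, rfl⟩
        exact h
    · have h : ts[j]? = none := List.getElem?_eq_none (not_lt.1 hj)
      simp only [vertexSet, subtreeAt, mem_ofPred_eq, h, mem_insert_iff,
        reduceCtorEq, mem_iUnion, mem_image, List.cons.injEq, false_or]
      constructor
      · simp
      · rintro ⟨i, q', -, rfl, rfl⟩
        exact absurd i.2 hj

theorem finite_vertexSet : ∀ t : PlaneTree, (vertexSet t).Finite
  | node ts => by
    rw [vertexSet_node]
    refine Finite.insert _ (finite_iUnion fun i => Finite.image _ ?_)
    exact finite_vertexSet (ts.get i)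
termination_by t => t
decreasing_by
  have := List.sizeOf_lt_of_mem (ts.get_mem i)
  simp only [node.sizeOf_spec]
  omega

@[to_additive]
theorem finprod_mem_vertexSet_node {M : Type*} [CommMonoid M] (ts : List PlaneTree)
    (f : List ℕ → M) :
    ∏ᶠ v ∈ vertexSet (node ts), f v =
      f [] * ∏ i : Fin ts.length, ∏ᶠ v ∈ vertexSet (ts.get i), f ((i : ℕ) :: v) := by
  rw [vertexSet_node, finprod_mem_insert, finprod_mem_iUnion, finprod_eq_prod_of_fintype]
  · congr 1
    refine Finset.prod_congr rfl fun i _ => ?_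
    exact finprod_mem_image fun a _ b _ h => (List.cons.inj h).2
  · intro i j hij
    refine Set.disjoint_left.2 ?_
    rintro _ ⟨a, -, rfl⟩ ⟨b, -, h⟩
    exact hij (Fin.ext (List.cons.inj h).1.symm)
  · exact fun i => (finite_vertexSet _).image _
  · simp
  · exact finite_iUnion fun i => (finite_vertexSet _).image _

theorem size_node (ts : List PlaneTree) :
    size (node ts) = 1 + ∑ i : Fin ts.length, size (ts.get i) := by
  have h : ∀ t, size t = ∑ᶠ v ∈ vertexSet t, 1 := fun t => finsum_one.symm
  simp only [h, finsum_mem_vertexSet_node]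

theorem gwProb_node (p : ℕ → ℝ≥0∞) (ts : List PlaneTree) :
    gwProb p (node ts) = p ts.length * ∏ i : Fin ts.length, gwProb p (ts.get i) := by
  rw [gwProb, finprod_mem_vertexSet_node]
  congr 1
  refine Finset.prod_congr rfl fun i _ => finprod_mem_congr rfl fun v _ => ?_
  simp [childCount, subtreeAt]

/-- A plane tree amounts to the number of subtrees at its root together with these subtrees. -/
def equivTuple : PlaneTree ≃ Σ k, Fin k → PlaneTree where
  toFun t := List.equivSigmaTuple t.children
  invFun v := node (List.equivSigmaTuple.symm v)
  left_inv := by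
    rintro ⟨ts⟩
    simp [children]
  right_inv v := List.equivSigmaTuple.apply_symm_apply v

theorem size_equivTuple (t : PlaneTree) :
    size t = 1 + ∑ i, size ((equivTuple t).2 i) := by
  cases t
  exact size_node _

theorem gwProb_equivTuple (p : ℕ → ℝ≥0∞) (t : PlaneTree) :
    gwProb p t = p (equivTuple t).1 * ∏ i, gwProb p ((equivTuple t).2 i) := by
  cases t
  exact gwProb_node p _

end PlaneTree

theorem ENNReal.tsum_prod_fin {α : Type*} (f : α → ℝ≥0∞) (k : ℕ) :
    ∑' v : Fin k → α, ∏ i, f (v i) = (∑' a, f a) ^ k := by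
  induction k with
  | zero => simp
  | succ k ih =>
    rw [← (Fin.consEquiv fun _ => α).tsum_eq, ENNReal.tsum_prod', pow_succ', ← ih,
      ← ENNReal.tsum_mul_right]
    simp [Fin.consEquiv, Fin.prod_univ_succ, ENNReal.tsum_mul_left]

theorem summable_norm_and_hasSum_prod_fin {α : Type*} {f : α → ℂ}
    (hf : Summable fun a => ‖f a‖) (k : ℕ) :
    (Summable fun v : Fin k → α => ‖∏ i, f (v i)‖) ∧
      HasSum (fun v : Fin k → α => ∏ i, f (v i)) ((∑' a, f a) ^ k) := by
  induction k with
  | zero =>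
    refine ⟨(hasSum_fintype _).summable, ?_⟩
    simp
  | succ k ih =>
    have h1 := hf.mul_norm ih.1
    have h2 := (summable_mul_of_summable_norm hf ih.1).hasSum
    rw [← tsum_mul_tsum_of_summable_norm hf ih.1, ih.2.tsum_eq, ← pow_succ'] at h2
    rw [← (Fin.consEquiv fun _ => α).summable_iff, ← (Fin.consEquiv fun _ => α).hasSum_iff]
    refine ⟨h1.congr fun x => ?_, h2.congr_fun fun x => ?_⟩ <;>
    simp [Fin.consEquiv, Fin.prod_univ_succ]

theorem tsum_gwProb_le_one {p : ℕ → ℝ≥0∞} (hp : ∑' k, p k = 1) :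
    ∑' t, gwProb p t ≤ 1 := by
  classical
  have key : ∀ n : ℕ, ∑' t, (if PlaneTree.size t ≤ n then gwProb p t else 0) ≤ 1 := by
    intro n
    induction n with
    | zero =>
      have h : ∀ t, ¬ PlaneTree.size t ≤ 0 := fun t => by
        rw [PlaneTree.size_equivTuple]; omega
      simp [h]
    | succ n ih =>
      calc ∑' t, (if PlaneTree.size t ≤ n + 1 then gwProb p t else 0)
          ≤ ∑' t, p (PlaneTree.equivTuple t).1 * ∏ i,
              (fun s => if PlaneTree.size s ≤ n then gwProb p s else 0)
                ((PlaneTree.equivTuple t).2 i) := by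
            refine ENNReal.tsum_le_tsum fun t => ?_
            split_ifs with h
            · rw [PlaneTree.gwProb_equivTuple]
              refine le_of_eq ?_
              congr 1
              refine Finset.prod_congr rfl fun i _ => ?_
              rw [PlaneTree.size_equivTuple] at h
              have := Finset.single_le_sum
                (f := fun i => PlaneTree.size ((PlaneTree.equivTuple t).2 i))
                (fun _ _ => Nat.zero_le _) (Finset.mem_univ i)
              exact (if_pos (by omega)).symm
            · exact zero_le
        _ = ∑' k, p k * (∑' t, if PlaneTree.size t ≤ n then gwProb p t else 0) ^ k := by
            rw [PlaneTree.equivTuple.tsum_eq (fun v : Σ k, Fin k → PlaneTree => p v.1 * ∏ i,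
              (fun s => if PlaneTree.size s ≤ n then gwProb p s else 0) (v.2 i)),
              ENNReal.tsum_sigma']
            refine tsum_congr fun k => ?_
            change ∑' v : Fin k → PlaneTree, p k * ∏ i,
              (fun s => if PlaneTree.size s ≤ n then gwProb p s else 0) (v i) = _
            rw [ENNReal.tsum_mul_left,
              ENNReal.tsum_prod_fin fun s => if PlaneTree.size s ≤ n then gwProb p s else 0]
        _ ≤ ∑' k, p k := ENNReal.tsum_le_tsum fun k =>
            mul_le_of_le_one_right' (pow_le_one' ih k)
        _ = 1 := hp
  rw [ENNReal.tsum_eq_iSup_sum]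
  refine iSup_le fun s => le_trans ?_ (key (s.sup PlaneTree.size))
  refine le_trans (Finset.sum_le_sum fun t ht => ?_) (ENNReal.sum_le_tsum s)
  rw [if_pos (Finset.le_sup ht)]

theorem summable_gwProb {p : ℕ → ℝ≥0∞} (hp : ∑' k, p k = 1) :
    Summable fun t => (gwProb p t).toReal :=
  ENNReal.summable_toReal (ne_top_of_le_ne_top ENNReal.one_ne_top (tsum_gwProb_le_one hp))

theorem norm_Fgen_term_le (p : ℕ → ℝ≥0∞) {z : ℂ} (hz : ‖z‖ ≤ 1) (t : PlaneTree) :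
    ‖((gwProb p t).toReal : ℂ) * z ^ PlaneTree.size t‖ ≤ (gwProb p t).toReal := by
  rw [norm_mul, norm_pow, Complex.norm_real, Real.norm_of_nonneg ENNReal.toReal_nonneg]
  exact mul_le_of_le_one_right ENNReal.toReal_nonneg (pow_le_one₀ (norm_nonneg _) hz)

theorem norm_Fgen_le_one {p : ℕ → ℝ≥0∞} (hp : ∑' k, p k = 1) {z : ℂ} (hz : ‖z‖ ≤ 1) :
    ‖Fgen p z‖ ≤ 1 := by
  refine le_trans (tsum_of_norm_bounded (summable_gwProb hp).hasSum (norm_Fgen_term_le p hz)) ?_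
  have h := tsum_gwProb_le_one hp
  rw [← ENNReal.tsum_toReal_eq fun t =>
    ENNReal.ne_top_of_tsum_ne_top (h.trans_lt ENNReal.one_lt_top).ne t]
  exact ENNReal.toReal_le_of_le_ofReal zero_le_one (by simpa using h)

/-- The probability generating function `Φ(w) = E w^ξ` of the offspring distribution. -/
noncomputable def Phi (p : ℕ → ℝ≥0∞) (w : ℂ) : ℂ :=
  ∑' k : ℕ, ((p k).toReal : ℂ) * w ^ k

theorem Fgen_eq_mul_Phi {p : ℕ → ℝ≥0∞} (hp : ∑' k, p k = 1) {z : ℂ} (hz : ‖z‖ ≤ 1) :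
    Fgen p z = z * Phi p (Fgen p z) := by
  have hs : Summable fun t => ‖((gwProb p t).toReal : ℂ) * z ^ PlaneTree.size t‖ :=
    .of_nonneg_of_le (fun _ => norm_nonneg _) (norm_Fgen_term_le p hz) (summable_gwProb hp)
  have hterm : ∀ t, ((gwProb p t).toReal : ℂ) * z ^ PlaneTree.size t =
      (fun v : Σ k, Fin k → PlaneTree => z * ((p v.1).toReal : ℂ) *
        ∏ i, (((gwProb p (v.2 i)).toReal : ℂ) * z ^ PlaneTree.size (v.2 i)))
          (PlaneTree.equivTuple t) := by
    intro t
    rw [PlaneTree.gwProb_equivTuple, PlaneTree.size_equivTuple]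
    simp only [ENNReal.toReal_mul, ENNReal.toReal_prod, pow_add, Finset.prod_mul_distrib,
      Finset.prod_pow_eq_pow_sum]
    push_cast
    ring
  have hs' : Summable fun v : Σ k, Fin k → PlaneTree => z * ((p v.1).toReal : ℂ) *
        ∏ i, (((gwProb p (v.2 i)).toReal : ℂ) * z ^ PlaneTree.size (v.2 i)) := by
    rw [← PlaneTree.equivTuple.summable_iff]
    exact hs.of_norm.congr hterm
  conv_lhs => rw [Fgen, tsum_congr hterm]
  rw [PlaneTree.equivTuple.tsum_eq (fun v : Σ k, Fin k → PlaneTree => z * ((p v.1).toReal : ℂ) *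
    ∏ i, (((gwProb p (v.2 i)).toReal : ℂ) * z ^ PlaneTree.size (v.2 i))), hs'.tsum_sigma,
    Phi, ← tsum_mul_left]
  refine tsum_congr fun k => ?_
  rw [← mul_assoc]
  change ∑' v : Fin k → PlaneTree, z * ((p k).toReal : ℂ) *
    ∏ i, (((gwProb p (v i)).toReal : ℂ) * z ^ PlaneTree.size (v i)) = _
  rw [tsum_mul_left, (summable_norm_and_hasSum_prod_fin hs k).2.tsum_eq, Fgen]

theorem hasSum_toReal {p : ℕ → ℝ≥0∞} (hp : ∑' k, p k = 1) :
    HasSum (fun k => (p k).toReal) 1 := by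
  have h := ENNReal.hasSum_toReal (f := p) (by simp [hp])
  rwa [← ENNReal.tsum_toReal_eq (ENNReal.ne_top_of_tsum_ne_top (by simp [hp])), hp,
    ENNReal.toReal_one] at h

theorem hasSum_natCast_mul_toReal {p : ℕ → ℝ≥0∞} (hmean : ∑' k : ℕ, (k : ℝ≥0∞) * p k = 1) :
    HasSum (fun k : ℕ => (k : ℝ) * (p k).toReal) 1 := by
  have h := ENNReal.hasSum_toReal (f := fun k : ℕ => (k : ℝ≥0∞) * p k) (by simp [hmean])
  rw [← ENNReal.tsum_toReal_eq (ENNReal.ne_top_of_tsum_ne_top (by simp [hmean])), hmean,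
    ENNReal.toReal_one] at h
  simpa using h

theorem summable_natCast_sq_mul_toReal {p : ℕ → ℝ≥0∞} (hp : ∑' k, p k = 1)
    (hvar_fin : xiVar p ≠ ⊤) : Summable fun k : ℕ => (k : ℝ) ^ 2 * (p k).toReal := by
  have h := ENNReal.summable_toReal hvar_fin
  simp only [ENNReal.toReal_mul, ENNReal.toReal_ofReal (sq_nonneg _)] at h
  refine .of_nonneg_of_le (fun k => by positivity) (fun k => ?_)
    ((h.add (hasSum_toReal hp).summable).mul_left 2)
  have h0 : 0 ≤ (p k).toReal := ENNReal.toReal_nonneg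
  nlinarith [mul_nonneg h0 (sq_nonneg ((k : ℝ) - 2))]

theorem toReal_apply_zero_pos {p : ℕ → ℝ≥0∞} (hp : ∑' k, p k = 1)
    (hmean : ∑' k : ℕ, (k : ℝ≥0∞) * p k = 1) (hvar_pos : 0 < xiVar p) :
    0 < (p 0).toReal := by
  have hfin : ∀ k, p k ≠ ⊤ := ENNReal.ne_top_of_tsum_ne_top (by simp [hp])
  refine ENNReal.toReal_pos (fun h0 => hvar_pos.ne' ?_) (hfin 0)
  have hsum := (hasSum_natCast_mul_toReal hmean).sub (hasSum_toReal hp)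
  rw [sub_self, hasSum_zero_iff_of_nonneg] at hsum
  · refine ENNReal.tsum_eq_zero.2 fun k => ?_
    have hk : (k : ℝ) * (p k).toReal - (p k).toReal = 0 := congrFun hsum k
    rw [← sub_one_mul] at hk
    rcases mul_eq_zero.1 hk with h | h
    · simp [h]
    · simp [((ENNReal.toReal_eq_zero_iff _).1 h).resolve_right (hfin k)]
  · intro k
    change 0 ≤ (k : ℝ) * (p k).toReal - (p k).toReal
    rcases Nat.eq_zero_or_pos k with rfl | hk
    · simp [h0]
    · have : (1 : ℝ) ≤ k := by exact_mod_cast hk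
      nlinarith [(p k).toReal_nonneg]

theorem toReal_add_toReal_le_one {p : ℕ → ℝ≥0∞} (hp : ∑' k, p k = 1) {j k : ℕ} (hjk : j ≠ k) :
    (p j).toReal + (p k).toReal ≤ 1 := by
  have h := (hasSum_toReal hp).summable.sum_le_tsum {j, k} fun _ _ => ENNReal.toReal_nonneg
  rwa [Finset.sum_pair hjk, (hasSum_toReal hp).tsum_eq] at h

theorem norm_Phi_term_le (p : ℕ → ℝ≥0∞) {w : ℂ} (hw : ‖w‖ ≤ 1) (k : ℕ) :
    ‖((p k).toReal : ℂ) * w ^ k‖ ≤ (p k).toReal := by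
  rw [norm_mul, norm_pow, Complex.norm_real, Real.norm_of_nonneg ENNReal.toReal_nonneg]
  exact mul_le_of_le_one_right ENNReal.toReal_nonneg (pow_le_one₀ (norm_nonneg _) hw)

theorem summable_Phi_term {p : ℕ → ℝ≥0∞} (hp : ∑' k, p k = 1) {w : ℂ} (hw : ‖w‖ ≤ 1) :
    Summable fun k => ((p k).toReal : ℂ) * w ^ k :=
  .of_norm_bounded (hasSum_toReal hp).summable (norm_Phi_term_le p hw)

theorem norm_Phi_le_one {p : ℕ → ℝ≥0∞} (hp : ∑' k, p k = 1) {w : ℂ} (hw : ‖w‖ ≤ 1) :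
    ‖Phi p w‖ ≤ 1 :=
  tsum_of_norm_bounded (hasSum_toReal hp) (norm_Phi_term_le p hw)

theorem norm_PhiDeriv_le {p : ℕ → ℝ≥0∞} (hmean : ∑' k : ℕ, (k : ℝ≥0∞) * p k = 1)
    {w : ℂ} (hw : ‖w‖ ≤ 1) :
    ‖PhiDeriv p w‖ ≤ 1 - (1 - (p 1).toReal) * (1 - ‖w‖) := by
  have h := ((hasSum_natCast_mul_toReal hmean).mul_right ‖w‖).add
    (hasSum_ite_eq 1 ((p 1).toReal * (1 - ‖w‖)))
  refine (tsum_of_norm_bounded h fun k => ?_).trans_eq (by ring)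
  rw [norm_mul, norm_mul, norm_pow, Complex.norm_natCast, Complex.norm_real,
    Real.norm_of_nonneg ENNReal.toReal_nonneg]
  rcases k with _ | _ | k
  · simp
  · simp only [zero_add, if_true]
    norm_num
    linarith
  · simp only [Nat.add_eq_right, Nat.add_eq_zero_iff, one_ne_zero, and_false, if_false, add_zero,
      add_tsub_cancel_right]
    refine mul_le_mul_of_nonneg_left ?_ (by positivity)
    exact pow_le_of_le_one (norm_nonneg _) hw (Nat.succ_ne_zero k)

theorem hasDerivAt_Phi {p : ℕ → ℝ≥0∞} (hp : ∑' k, p k = 1)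
    (hmean : ∑' k : ℕ, (k : ℝ≥0∞) * p k = 1) {w : ℂ} (hw : ‖w‖ < 1) :
    HasDerivAt (Phi p) (PhiDeriv p w) w := by
  refine hasDerivAt_tsum_of_isPreconnected (t := Metric.ball 0 1) (y₀ := 0)
    (g := fun k (w : ℂ) => ((p k).toReal : ℂ) * w ^ k)
    (g' := fun k w => (k : ℂ) * ((p k).toReal : ℂ) * w ^ (k - 1))
    (hasSum_natCast_mul_toReal hmean).summable Metric.isOpen_ball
    (convex_ball _ _).isPreconnected ?_ ?_ (by simp) (summable_Phi_term hp (by simp))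
    (by simpa using hw)
  · intro k y _
    convert! (hasDerivAt_pow k y).const_mul ((p k).toReal : ℂ) using 1
    ring
  · intro k y hy
    rw [norm_mul, norm_mul, norm_pow, Complex.norm_natCast, Complex.norm_real,
      Real.norm_of_nonneg ENNReal.toReal_nonneg]
    refine mul_le_of_le_one_right (by positivity) (pow_le_one₀ (norm_nonneg _) ?_)
    exact (mem_ball_zero_iff.1 hy).le

theorem norm_Phi_sub_Phi_le {p : ℕ → ℝ≥0∞} (hp : ∑' k, p k = 1)
    (hmean : ∑' k : ℕ, (k : ℝ≥0∞) * p k = 1) {R : ℝ} (hR : R < 1) {v w : ℂ}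
    (hv : ‖v‖ ≤ R) (hw : ‖w‖ ≤ R) :
    ‖Phi p v - Phi p w‖ ≤ (1 - (1 - (p 1).toReal) * (1 - R)) * ‖v - w‖ := by
  have h1 : (p 1).toReal ≤ 1 := by
    linarith [toReal_add_toReal_le_one hp zero_ne_one, (p 0).toReal_nonneg]
  refine (convex_closedBall (0 : ℂ) R).norm_image_sub_le_of_norm_hasDerivWithin_le
    (f' := PhiDeriv p) (fun x hx => ?_) (fun x hx => ?_) (by simpa using hw) (by simpa using hv)
  all_goals have hx' : ‖x‖ ≤ R := by simpa using hx
  · exact (hasDerivAt_Phi hp hmean (hx'.trans_lt hR)).hasDerivWithinAt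
  · refine (norm_PhiDeriv_le hmean (hx'.trans hR.le)).trans ?_
    nlinarith

theorem norm_pow_sub_one_le {w : ℂ} (hw : ‖w‖ ≤ 1) (k : ℕ) : ‖w ^ k - 1‖ ≤ k * ‖1 - w‖ := by
  induction k with
  | zero => simp
  | succ k ih =>
    have h : w ^ (k + 1) - 1 = w * (w ^ k - 1) - (1 - w) := by ring
    rw [h]
    refine (norm_sub_le _ _).trans ?_
    rw [norm_mul]
    push_cast
    nlinarith [norm_nonneg (w ^ k - 1)]

theorem norm_pow_sub_affine_le {w : ℂ} (hw : ‖w‖ ≤ 1) (k : ℕ) :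
    ‖w ^ k - (1 + k * (w - 1))‖ ≤ k ^ 2 * ‖1 - w‖ ^ 2 := by
  induction k with
  | zero => simp
  | succ k ih =>
    have h : w ^ (k + 1) - (1 + ((k + 1 : ℕ) : ℂ) * (w - 1)) =
        (w ^ k - (1 + k * (w - 1))) + (w ^ k - 1) * (w - 1) := by
      push_cast
      ring
    rw [h]
    refine (norm_add_le _ _).trans ?_
    rw [norm_mul, norm_sub_rev w 1]
    have h2 := mul_le_mul_of_nonneg_right (norm_pow_sub_one_le hw k) (norm_nonneg (1 - w))
    push_cast
    nlinarith [mul_nonneg (Nat.cast_nonneg (α := ℝ) k) (sq_nonneg ‖1 - w‖), sq_nonneg ‖1 - w‖]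

theorem norm_Phi_sub_self_le {p : ℕ → ℝ≥0∞} (hp : ∑' k, p k = 1)
    (hmean : ∑' k : ℕ, (k : ℝ≥0∞) * p k = 1) (hvar_fin : xiVar p ≠ ⊤)
    {w : ℂ} (hw : ‖w‖ ≤ 1) :
    ‖Phi p w - w‖ ≤ (∑' k : ℕ, (k : ℝ) ^ 2 * (p k).toReal) * ‖1 - w‖ ^ 2 := by
  have h1 : HasSum (fun k => ((p k).toReal : ℂ)) 1 := by
    simpa using Complex.hasSum_ofReal.2 (hasSum_toReal hp)
  have h2 : HasSum (fun k : ℕ => (k : ℂ) * ((p k).toReal : ℂ)) 1 := by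
    simpa using Complex.hasSum_ofReal.2 (hasSum_natCast_mul_toReal hmean)
  have h := (summable_Phi_term hp hw).hasSum.sub (h1.add (h2.mul_right (w - 1)))
  have hs := (summable_natCast_sq_mul_toReal hp hvar_fin).hasSum.mul_right (‖1 - w‖ ^ 2)
  have heq : Phi p w - w = ∑' k : ℕ, ((p k).toReal : ℂ) * (w ^ k - (1 + k * (w - 1))) := by
    have hw1 : (1 : ℂ) + 1 * (w - 1) = w := by ring
    rw [hw1] at h
    exact h.tsum_eq.symm.trans (tsum_congr fun k => by ring)
  rw [heq]
  refine tsum_of_norm_bounded hs fun k => ?_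
  rw [norm_mul, Complex.norm_real, Real.norm_of_nonneg ENNReal.toReal_nonneg]
  nlinarith [mul_le_mul_of_nonneg_left (norm_pow_sub_affine_le hw k) (p k).toReal_nonneg]

theorem norm_ofReal_add_mul_le {a b : ℝ} (ha : 0 ≤ a) (hb : 0 ≤ b) (hab : a + b ≤ 1)
    {v : ℂ} (hv : ‖v‖ = 1) :
    ‖(a : ℂ) + b * v‖ ≤ a + b - a * b / 2 * ‖1 - v‖ ^ 2 := by
  have hv2 : v.re * v.re + v.im * v.im = 1 := by
    rw [← Complex.normSq_apply, Complex.normSq_eq_norm_sq, hv, one_pow]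
  have h1 : ‖1 - v‖ ^ 2 = 2 - 2 * v.re := by
    rw [← Complex.normSq_eq_norm_sq, Complex.normSq_apply]
    simp
    linarith
  have h2 : ‖(a : ℂ) + b * v‖ ^ 2 = (a + b) ^ 2 - a * b * ‖1 - v‖ ^ 2 := by
    rw [h1, ← Complex.normSq_eq_norm_sq, Complex.normSq_apply]
    simp
    linear_combination b ^ 2 * hv2
  have h3 : ‖1 - v‖ ^ 2 ≤ 4 := by
    rw [h1]
    nlinarith [sq_nonneg v.im]
  have h4 : 0 ≤ a * b * ‖1 - v‖ ^ 2 := by positivity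
  refine abs_le_of_sq_le_sq' ?_ ?_ |>.2
  · rw [h2]
    nlinarith [sq_nonneg (a * b * ‖1 - v‖ ^ 2)]
  · nlinarith [mul_le_mul_of_nonneg_left h3 (mul_nonneg ha hb), mul_nonneg ha hb]

theorem summable_pgf_real {p : ℕ → ℝ≥0∞} (hp : ∑' k, p k = 1) {r : ℝ} (hr0 : 0 ≤ r)
    (hr1 : r ≤ 1) : Summable fun k => (p k).toReal * r ^ k :=
  .of_nonneg_of_le (fun k => by positivity)
    (fun k => mul_le_of_le_one_right ENNReal.toReal_nonneg (pow_le_one₀ hr0 hr1))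
    (hasSum_toReal hp).summable

/-- A single nonzero atom `k` of the offspring distribution, together with the atom `0`, forces
a gain in the triangle inequality for `Φ`. -/
theorem norm_Phi_add_le {p : ℕ → ℝ≥0∞} (hp : ∑' k, p k = 1) {k : ℕ} (hk : k ≠ 0)
    {r : ℝ} (hr0 : 0 ≤ r) (hr1 : r ≤ 1) {u : ℂ} (hu : ‖u‖ = 1) :
    (p 0).toReal * ((p k).toReal * r ^ k) / 2 * ‖1 - u ^ k‖ ^ 2 ≤
      ∑' j, (p j).toReal * r ^ j - ‖Phi p (r * u)‖ := by
  have hru : ‖(r : ℂ) * u‖ = r := by simp [hu, abs_of_nonneg hr0]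
  have hs := summable_Phi_term hp (hru.trans_le hr1)
  have hs' := summable_pgf_real hp hr0 hr1
  have hsplit := hs.sum_add_tsum_compl (s := {0, k})
  have hsplit' := hs'.sum_add_tsum_compl (s := {0, k})
  rw [Finset.sum_pair hk.symm] at hsplit hsplit'
  have htail : ‖∑' j : ↑((({0, k} : Finset ℕ) : Set ℕ)ᶜ),
      ((p j).toReal : ℂ) * ((r : ℂ) * u) ^ (j : ℕ)‖ ≤
      ∑' j : ↑((({0, k} : Finset ℕ) : Set ℕ)ᶜ), (p j).toReal * r ^ (j : ℕ) := by
    refine tsum_of_norm_bounded (hs'.subtype _).hasSum fun j => ?_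
    rw [norm_mul, norm_pow, hru, Complex.norm_real, Real.norm_of_nonneg ENNReal.toReal_nonneg]
    rfl
  have hhead := norm_ofReal_add_mul_le (a := (p 0).toReal) (b := (p k).toReal * r ^ k)
    (v := u ^ k) ENNReal.toReal_nonneg (by positivity)
    (by linarith [toReal_add_toReal_le_one hp hk.symm,
      mul_le_of_le_one_right (p k).toReal_nonneg (pow_le_one₀ (n := k) hr0 hr1)]) (by simp [hu])
  have hhead' : ((p 0).toReal : ℂ) * (r * u) ^ 0 + ((p k).toReal : ℂ) * (r * u) ^ k =
      ((p 0).toReal : ℂ) + (((p k).toReal * r ^ k : ℝ) : ℂ) * u ^ k := by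
    push_cast
    ring
  rw [Phi, ← hsplit, ← hsplit', hhead']
  have := norm_add_le (((p 0).toReal : ℂ) + (((p k).toReal * r ^ k : ℝ) : ℂ) * u ^ k)
    (∑' j : ↑((({0, k} : Finset ℕ) : Set ℕ)ᶜ), ((p j).toReal : ℂ) * ((r : ℂ) * u) ^ (j : ℕ))
  simp only [pow_zero, mul_one]
  linarith

theorem exists_norm_one_sub_sq_le {p : ℕ → ℝ≥0∞} (hp : ∑' k, p k = 1)
    (h0 : 0 < (p 0).toReal) (hspan : ∀ e : ℕ, (∀ k : ℕ, p k ≠ 0 → e ∣ k) → e ≤ 1) :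
    ∃ C : ℝ, 0 ≤ C ∧ ∀ r : ℝ, 1 / 2 ≤ r → r ≤ 1 → ∀ u : ℂ, ‖u‖ = 1 →
      ‖1 - u‖ ^ 2 ≤ C * (∑' j, (p j).toReal * r ^ j - ‖Phi p (r * u)‖) := by
  let H : AddSubgroup ℤ :=
    { carrier := {k | ∃ C : ℝ, 0 ≤ C ∧ ∀ r : ℝ, 1 / 2 ≤ r → r ≤ 1 → ∀ u : ℂ, ‖u‖ = 1 →
        ‖1 - u ^ k‖ ^ 2 ≤ C * (∑' j, (p j).toReal * r ^ j - ‖Phi p (r * u)‖)}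
      zero_mem' := ⟨0, le_rfl, fun r _ _ u _ => by simp⟩
      add_mem' := by
        rintro a b ⟨C, hC, h⟩ ⟨D, hD, h'⟩
        refine ⟨2 * C + 2 * D, by positivity, fun r hr hr1 u hu => ?_⟩
        have hu0 : u ≠ 0 := norm_ne_zero_iff.1 (by simp [hu])
        have e : 1 - u ^ (a + b) = (1 - u ^ a) + u ^ a * (1 - u ^ b) := by
          rw [zpow_add₀ hu0]
          ring
        have hle : ‖1 - u ^ (a + b)‖ ≤ ‖1 - u ^ a‖ + ‖1 - u ^ b‖ := by
          rw [e]
          refine (norm_add_le _ _).trans_eq ?_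
          rw [norm_mul, norm_zpow, hu, one_zpow, one_mul]
        have := h r hr hr1 u hu
        have := h' r hr hr1 u hu
        nlinarith [norm_nonneg (1 - u ^ (a + b)), sq_nonneg (‖1 - u ^ a‖ - ‖1 - u ^ b‖),
          norm_nonneg (1 - u ^ a), norm_nonneg (1 - u ^ b)]
      neg_mem' := by
        rintro a ⟨C, hC, h⟩
        refine ⟨C, hC, fun r hr hr1 u hu => ?_⟩
        have hu0 : u ≠ 0 := norm_ne_zero_iff.1 (by simp [hu])
        have e : 1 - u ^ (-a) = -(u ^ (-a) * (1 - u ^ a)) := by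
          rw [mul_sub, ← zpow_add₀ hu0]
          simp
        rw [e, norm_neg, norm_mul, norm_zpow, hu, one_zpow, one_mul]
        exact h r hr hr1 u hu }
  have hmem : ∀ k : ℕ, p k ≠ 0 → (k : ℤ) ∈ H := by
    intro k hk
    rcases Nat.eq_zero_or_pos k with rfl | hkpos
    · exact H.zero_mem
    have hpk : 0 < (p k).toReal :=
      ENNReal.toReal_pos hk (ENNReal.ne_top_of_tsum_ne_top (by simp [hp]) k)
    have hc : 0 < (p 0).toReal * ((p k).toReal * (1 / 2) ^ k) / 2 := by positivity
    refine ⟨((p 0).toReal * ((p k).toReal * (1 / 2) ^ k) / 2)⁻¹, by positivity,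
      fun r hr hr1 u hu => ?_⟩
    rw [le_inv_mul_iff₀ hc, zpow_natCast]
    refine le_trans ?_ (norm_Phi_add_le hp hkpos.ne' (by linarith) hr1 hu)
    gcongr
  obtain ⟨e, he⟩ := Int.subgroup_cyclic H
  have hdvd : ∀ k : ℕ, p k ≠ 0 → e.natAbs ∣ k := by
    intro k hk
    have h := hmem k hk
    rw [he, ← AddSubgroup.zmultiples_eq_closure, Int.mem_zmultiples_iff] at h
    exact Int.natAbs_dvd_natAbs.2 h
  have he0 : e.natAbs ≠ 0 := by
    intro h
    have := hspan 2 fun k hk => by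
      have := hdvd k hk
      rw [h, zero_dvd_iff] at this
      simp [this]
    omega
  have he1 : e.natAbs = 1 := le_antisymm (hspan _ hdvd) (Nat.one_le_iff_ne_zero.2 he0)
  have h1 : (1 : ℤ) ∈ H := by
    rw [he, ← AddSubgroup.zmultiples_eq_closure, Int.mem_zmultiples_iff]
    exact Int.natAbs_dvd.1 (by simp [he1])
  obtain ⟨C, hC, h⟩ := h1
  exact ⟨C, hC, fun r hr hr1 u hu => by simpa using h r hr hr1 u hu⟩

/-- On the closed unit disc, a solution `w` of `w = z Φ(w)` satisfies `|1 - z| = O((1 - |w|)²)`. -/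
theorem exists_norm_one_sub_le_mul_sq {p : ℕ → ℝ≥0∞} (hp : ∑' k, p k = 1)
    (hmean : ∑' k : ℕ, (k : ℝ≥0∞) * p k = 1) (hvar_pos : 0 < xiVar p) (hvar_fin : xiVar p ≠ ⊤)
    (hspan : ∀ e : ℕ, (∀ k : ℕ, p k ≠ 0 → e ∣ k) → e ≤ 1) :
    ∃ C : ℝ, 0 < C ∧ ∀ z w : ℂ, ‖z‖ ≤ 1 → ‖w‖ ≤ 1 → w = z * Phi p w →
      ‖1 - z‖ ≤ C * (1 - ‖w‖) ^ 2 := by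
  obtain ⟨A, hA, hspanle⟩ :=
    exists_norm_one_sub_sq_le hp (toReal_apply_zero_pos hp hmean hvar_pos) hspan
  set B := ∑' k : ℕ, (k : ℝ) ^ 2 * (p k).toReal with hB
  have hB0 : 0 ≤ B := tsum_nonneg fun k => by positivity
  refine ⟨8 + 4 * B * (A * B + 1), by positivity, fun z w hz hw hzw => ?_⟩
  have hz2 : ‖1 - z‖ ≤ 2 := (norm_sub_le _ _).trans (by simp; linarith)
  rcases le_or_gt ‖w‖ (1 / 2) with hw2 | hw2
  · have : 0 ≤ 4 * B * (A * B + 1) * (1 - ‖w‖) ^ 2 := by positivity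
    nlinarith
  · have hw0 : (‖w‖ : ℂ) ≠ 0 := by
      exact_mod_cast (by linarith : (0 : ℝ) < ‖w‖).ne'
    set u : ℂ := w / ‖w‖ with hu
    have hu1 : ‖u‖ = 1 := by
      rw [hu, norm_div, Complex.norm_real, norm_norm, div_self]
      linarith
    have hwu : (‖w‖ : ℂ) * u = w := by rw [hu, mul_div_cancel₀ _ hw0]
    have h1 := hspanle ‖w‖ hw2.le hw u hu1
    rw [hwu] at h1
    have hnorm : ‖w‖ ≤ ‖Phi p w‖ := by
      conv_lhs => rw [hzw, norm_mul]
      exact mul_le_of_le_one_left (norm_nonneg _) hz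
    have hreal : ∑' j, (p j).toReal * ‖w‖ ^ j - ‖w‖ ≤ B * (1 - ‖w‖) ^ 2 := by
      have h := norm_Phi_sub_self_le hp hmean hvar_fin (w := (‖w‖ : ℂ)) (by simpa using hw)
      have hPhi : Phi p (‖w‖ : ℂ) = ((∑' j, (p j).toReal * ‖w‖ ^ j : ℝ) : ℂ) := by
        rw [Phi, Complex.ofReal_tsum]
        push_cast
        rfl
      rw [hPhi, ← Complex.ofReal_one, ← Complex.ofReal_sub, ← Complex.ofReal_sub,
        Complex.norm_real, Complex.norm_real, Real.norm_eq_abs, Real.norm_eq_abs, sq_abs] at h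
      exact (le_abs_self _).trans h
    have h2 : ‖1 - u‖ ^ 2 ≤ A * B * (1 - ‖w‖) ^ 2 := by
      rw [mul_assoc]
      exact h1.trans (mul_le_mul_of_nonneg_left (by linarith) hA)
    have h3 : ‖1 - w‖ ≤ ‖1 - u‖ + (1 - ‖w‖) := by
      have e : 1 - w = (1 - u) + u * ((1 - ‖w‖ : ℝ) : ℂ) := by
        conv_lhs => rw [← hwu]
        push_cast
        ring
      rw [e]
      refine (norm_add_le _ _).trans_eq ?_
      rw [norm_mul, hu1, one_mul, Complex.norm_real, Real.norm_of_nonneg (by linarith)]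
    have h4 : ‖1 - w‖ ^ 2 ≤ 2 * (A * B + 1) * (1 - ‖w‖) ^ 2 := by
      nlinarith [sq_nonneg (‖1 - u‖ - (1 - ‖w‖)), norm_nonneg (1 - w)]
    have h5 : ‖Phi p w‖ * ‖1 - z‖ ≤ B * ‖1 - w‖ ^ 2 := by
      refine le_trans (le_of_eq ?_) (norm_Phi_sub_self_le hp hmean hvar_fin hw)
      rw [← norm_mul]
      congr 1
      linear_combination hzw
    have h6 : 1 / 2 * ‖1 - z‖ ≤ ‖Phi p w‖ * ‖1 - z‖ :=
      mul_le_mul_of_nonneg_right (by linarith) (norm_nonneg _)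
    nlinarith [mul_le_mul_of_nonneg_left h4 hB0, sq_nonneg (1 - ‖w‖)]

/-- `w` is a solution of `w = z Φ(w)` in the open unit disc at which an explicit bound certifies
`|z Φ'(w)| < 1`. -/
def IsAttractingSolution (p : ℕ → ℝ≥0∞) (z w : ℂ) : Prop :=
  ‖w‖ < 1 ∧ w = z * Phi p w ∧ ‖z‖ * (1 - (1 - (p 1).toReal) * (1 - ‖w‖)) < 1

theorem IsAttractingSolution.unique {p : ℕ → ℝ≥0∞} (hp : ∑' k, p k = 1)
    (hmean : ∑' k : ℕ, (k : ℝ≥0∞) * p k = 1) {z v w : ℂ}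
    (hv : IsAttractingSolution p z v) (hw : IsAttractingSolution p z w) : v = w := by
  wlog h : ‖v‖ ≤ ‖w‖ generalizing v w
  · exact (this hw hv (le_of_not_ge h)).symm
  by_contra hne
  have hpos : 0 < ‖v - w‖ := norm_pos_iff.2 (sub_ne_zero.2 hne)
  have h1 := norm_Phi_sub_Phi_le hp hmean hw.1 h le_rfl
  have h2 : ‖v - w‖ = ‖z‖ * ‖Phi p v - Phi p w‖ := by
    rw [← norm_mul, mul_sub, ← hv.2.1, ← hw.2.1]
  have h3 := mul_le_mul_of_nonneg_left h1 (norm_nonneg z)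
  rw [← h2, ← mul_assoc] at h3
  nlinarith [hw.2.2]

theorem IsAttractingSolution.norm_mul_PhiDeriv_lt_one {p : ℕ → ℝ≥0∞}
    (hmean : ∑' k : ℕ, (k : ℝ≥0∞) * p k = 1) {z w : ℂ} (h : IsAttractingSolution p z w) :
    ‖z * PhiDeriv p w‖ < 1 := by
  rw [norm_mul]
  exact (mul_le_mul_of_nonneg_left (norm_PhiDeriv_le hmean h.1.le) (norm_nonneg z)).trans_lt h.2.2

theorem IsAttractingSolution.exists_local_branch {p : ℕ → ℝ≥0∞} (hp : ∑' k, p k = 1)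
    (hmean : ∑' k : ℕ, (k : ℝ≥0∞) * p k = 1) (h0 : 0 < (p 0).toReal) {z w : ℂ}
    (h : IsAttractingSolution p z w) :
    ∃ g : ℂ → ℂ, DifferentiableAt ℂ g z ∧ ∀ᶠ y in nhds z, IsAttractingSolution p y (g y) := by
  have hPhi0 : Phi p w ≠ 0 := by
    intro hzero
    have hw : w = 0 := by
      have := h.2.1
      rwa [hzero, mul_zero] at this
    rw [hw, Phi, tsum_eq_single 0 (fun k hk => by simp [hk])] at hzero
    simp only [pow_zero, mul_one, Complex.ofReal_eq_zero] at hzero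
    exact h0.ne' hzero
  have hdiff : DifferentiableOn ℂ (Phi p) (Metric.ball 0 1) := fun x hx =>
    (hasDerivAt_Phi hp hmean (mem_ball_zero_iff.1 hx)).differentiableAt.differentiableWithinAt
  have hstrict := (hdiff.analyticAt
    (Metric.isOpen_ball.mem_nhds (mem_ball_zero_iff.2 h.1))).hasStrictDerivAt
  rw [(hasDerivAt_Phi hp hmean h.1).deriv] at hstrict
  have hG := (hasStrictDerivAt_id w).fun_div hstrict hPhi0
  have hz : w / Phi p w = z := by
    rw [div_eq_iff hPhi0]
    exact h.2.1
  have hne : (1 * Phi p w - id w * PhiDeriv p w) / Phi p w ^ 2 ≠ 0 := by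
    refine div_ne_zero ?_ (pow_ne_zero 2 hPhi0)
    have e : 1 * Phi p w - id w * PhiDeriv p w = Phi p w * (1 - z * PhiDeriv p w) := by
      rw [id, ← hz]
      field_simp
    rw [e]
    refine mul_ne_zero hPhi0 fun h1 => ?_
    have h2 := h.norm_mul_PhiDeriv_lt_one hmean
    rw [← sub_eq_zero.1 h1, norm_one] at h2
    exact lt_irrefl _ h2
  have hder := hG.to_localInverse hne
  have hright := hG.eventually_right_inverse hne
  have hval : hG.localInverse _ _ _ hne (id w / Phi p w) = w :=
    HasStrictFDerivAt.localInverse_apply_image _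
  set g := hG.localInverse _ _ _ hne
  simp only [id] at hder hright hval
  rw [hz] at hder hright hval
  have hcont : ContinuousAt g z := hder.hasDerivAt.continuousAt
  have hPhi_cont : ContinuousAt (Phi p) (g z) := by
    rw [hval]
    exact hstrict.hasDerivAt.continuousAt
  refine ⟨g, hder.hasDerivAt.differentiableAt, ?_⟩
  have e1 : ∀ᶠ y in nhds z, ‖g y‖ < 1 :=
    hcont.norm.eventually_lt continuousAt_const (by rw [hval]; exact h.1)
  have e2 : ∀ᶠ y in nhds z, ‖y‖ * (1 - (1 - (p 1).toReal) * (1 - ‖g y‖)) < 1 :=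
    ContinuousAt.eventually_lt (by fun_prop) continuousAt_const (by rw [hval]; exact h.2.2)
  have e3 : ∀ᶠ y in nhds z, Phi p (g y) ≠ 0 :=
    (ContinuousAt.comp (g := Phi p) hPhi_cont hcont).eventually_ne (by simpa [hval] using hPhi0)
  filter_upwards [e1, e2, e3, hright] with y h1 h2 h3 h4
  exact ⟨h1, (div_eq_iff h3).1 h4, h2⟩

open Classical in
/-- The attracting solution of `w = z Φ(w)`, when there is one. -/
noncomputable def attractingSolution (p : ℕ → ℝ≥0∞) (z : ℂ) : ℂ :=
  if h : ∃ w, IsAttractingSolution p z w then h.choose else 0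

theorem IsAttractingSolution.eq {p : ℕ → ℝ≥0∞} (hp : ∑' k, p k = 1)
    (hmean : ∑' k : ℕ, (k : ℝ≥0∞) * p k = 1) {z w : ℂ} (h : IsAttractingSolution p z w) :
    attractingSolution p z = w := by
  have hex : ∃ w, IsAttractingSolution p z w := ⟨w, h⟩
  rw [attractingSolution, dif_pos hex]
  exact hex.choose_spec.unique hp hmean h

theorem IsAttractingSolution.analyticAt {p : ℕ → ℝ≥0∞} (hp : ∑' k, p k = 1)
    (hmean : ∑' k : ℕ, (k : ℝ≥0∞) * p k = 1) (h0 : 0 < (p 0).toReal) {z w : ℂ}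
    (h : IsAttractingSolution p z w) : AnalyticAt ℂ (attractingSolution p) z := by
  have hdiff : ∀ {z w : ℂ}, IsAttractingSolution p z w →
      DifferentiableAt ℂ (attractingSolution p) z := by
    intro z w h
    obtain ⟨g, hg, hsol⟩ := h.exists_local_branch hp hmean h0
    exact hg.congr_of_eventuallyEq (hsol.mono fun y hy => hy.eq hp hmean)
  rw [Complex.analyticAt_iff_eventually_differentiableAt]
  obtain ⟨g, -, hsol⟩ := h.exists_local_branch hp hmean h0
  exact hsol.mono fun y hy => hdiff hy

/-- Starting from a solution `w₀` of `w₀ = ζ Φ(w₀)` in the open disc, the equation can be solved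
for all `z` at distance `O((1 - |w₀|)²)` from `ζ`. -/
theorem exists_solution_near {p : ℕ → ℝ≥0∞} (hp : ∑' k, p k = 1)
    (hmean : ∑' k : ℕ, (k : ℝ≥0∞) * p k = 1) {ζ w₀ z : ℂ} {a d : ℝ}
    (ha : a = 1 - (p 1).toReal) (ha0 : 0 < a) (hd : d = 1 - ‖w₀‖) (hd0 : 0 < d)
    (hw₀ : w₀ = ζ * Phi p w₀) (hz : ‖z‖ ≤ 1 + a / 8 * d ^ 2)
    (hzζ : ‖z - ζ‖ ≤ a / 8 * d ^ 2) :
    ∃ w, ‖w‖ < 1 ∧ w = z * Phi p w ∧ ‖z‖ * (1 - a * (1 - ‖w‖)) ≤ 1 - a * d / 4 := by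
  have ha1 : a ≤ 1 := by linarith [(p 1).toReal_nonneg]
  have hd1 : d ≤ 1 := by linarith [norm_nonneg w₀]
  have had : a * d ≤ 1 := mul_le_one₀ ha1 hd0.le hd1
  have hball : ∀ w ∈ Metric.closedBall w₀ (d / 2), ‖w‖ ≤ 1 - d / 2 := by
    intro w hw
    rw [mem_closedBall_iff_norm] at hw
    linarith [norm_le_norm_add_norm_sub' w w₀]
  have hq : ∀ {R : ℝ}, R ≤ 1 - d / 2 → ‖z‖ * (1 - a * (1 - R)) ≤ 1 - a * d / 4 := by
    intro R hR
    have h1 : 1 - a * (1 - R) ≤ 1 - a * (d / 2) := by nlinarith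
    have h2 : 0 ≤ 1 - a * (d / 2) := by nlinarith
    have h3 := mul_le_mul_of_nonneg_left h1 (norm_nonneg z)
    have h4 := mul_le_mul_of_nonneg_right hz h2
    have h5 : 0 ≤ a * d * (1 - d) := mul_nonneg (by positivity) (by linarith)
    have h6 : 0 ≤ a * d ^ 2 * (a * d) := by positivity
    nlinarith
  have hlip : ∀ v ∈ Metric.closedBall w₀ (d / 2), ∀ w ∈ Metric.closedBall w₀ (d / 2),
      ‖z * Phi p v - z * Phi p w‖ ≤ (1 - a * d / 4) * ‖v - w‖ := by
    intro v hv w hw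
    have h := norm_Phi_sub_Phi_le hp hmean (by linarith) (hball v hv) (hball w hw)
    rw [← ha] at h
    rw [← mul_sub, norm_mul]
    refine (mul_le_mul_of_nonneg_left h (norm_nonneg z)).trans ?_
    rw [← mul_assoc]
    exact mul_le_mul_of_nonneg_right (hq le_rfl) (norm_nonneg _)
  have hcenter : w₀ ∈ Metric.closedBall w₀ (d / 2) := Metric.mem_closedBall_self (by positivity)
  have hmaps : MapsTo (fun w => z * Phi p w) (Metric.closedBall w₀ (d / 2))
      (Metric.closedBall w₀ (d / 2)) := by
    intro w hw
    have h1 := hlip w hw w₀ hcenter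
    have h2 : ‖z * Phi p w₀ - w₀‖ ≤ a / 8 * d ^ 2 := by
      have e : z * Phi p w₀ - w₀ = (z - ζ) * Phi p w₀ := by
        rw [sub_mul, ← hw₀]
      rw [e, norm_mul]
      exact (mul_le_of_le_one_right (norm_nonneg _)
        (norm_Phi_le_one hp (by linarith))).trans hzζ
    have h3 := norm_sub_le_norm_sub_add_norm_sub (z * Phi p w) (z * Phi p w₀) w₀
    rw [mem_closedBall_iff_norm] at hw ⊢
    have h4 := mul_le_mul_of_nonneg_left hw (by linarith : 0 ≤ 1 - a * d / 4)
    nlinarith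
  have hcontr : ContractingWith (Real.toNNReal (1 - a * d / 4))
      (hmaps.restrict _ _ _) := by
    refine ⟨?_, LipschitzWith.of_dist_le_mul ?_⟩
    · rw [Real.toNNReal_lt_one]
      nlinarith [mul_pos ha0 hd0]
    · rintro ⟨v, hv⟩ ⟨w, hw⟩
      rw [Real.coe_toNNReal _ (by linarith), Subtype.dist_eq, Subtype.dist_eq, dist_eq_norm,
        dist_eq_norm]
      exact hlip v hv w hw
  obtain ⟨w, hw, hfix, -⟩ := hcontr.exists_fixedPoint'
    Metric.isClosed_closedBall.isComplete hmaps hcenter (edist_ne_top _ _)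
  exact ⟨w, (hball w hw).trans_lt (by linarith), hfix.symm, hq (hball w hw)⟩

theorem norm_sub_one_le_of_mem_Delta {β : ℝ} (hβ0 : 0 < β) (hβ : β ≤ 1 / 4) {z : ℂ}
    (hz : z ∈ Delta β (β ^ 2)) : ‖z‖ - 1 ≤ 2 * β * ‖1 - z‖ := by
  obtain ⟨hz1, -, harg⟩ := hz
  rw [norm_sub_rev]
  rcases le_or_gt β ‖z - 1‖ with h | h
  · nlinarith
  · have hcos : Real.cos (Complex.arg (z - 1)) ≤ β := by
      rw [← Real.cos_abs]
      refine (Real.cos_le_cos_of_nonneg_of_le_pi (by linarith [Real.pi_gt_three])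
        (Complex.abs_arg_le_pi _) harg.le).trans ?_
      rw [Real.cos_pi_div_two_sub]
      exact Real.sin_le hβ0.le
    have hre : (z - 1).re ≤ β * ‖z - 1‖ := by
      rw [← Complex.norm_mul_cos_arg, mul_comm]
      exact mul_le_mul_of_nonneg_right hcos (norm_nonneg _)
    have hsq : ‖z‖ ^ 2 = 1 + 2 * (z - 1).re + ‖z - 1‖ ^ 2 := by
      rw [← Complex.normSq_eq_norm_sq, ← Complex.normSq_eq_norm_sq, Complex.normSq_apply,
        Complex.normSq_apply]
      simp
      ring
    nlinarith [norm_nonneg (z - 1), sq_nonneg (‖z‖ - 1)]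

theorem mul_rpow_half_le {a C d x N : ℝ} (ha : 0 ≤ a) (hC : 0 < C) (hd : 0 ≤ d)
    (hx : x ≤ C * d ^ 2) (hN : a * d ≤ N) : a / √C * x ^ ((1 : ℝ) / 2) ≤ N := by
  rw [← Real.sqrt_eq_rpow]
  refine le_trans ?_ hN
  have h := Real.sqrt_le_sqrt hx
  rw [Real.sqrt_mul hC.le, Real.sqrt_sq hd] at h
  have hs : 0 < √C := Real.sqrt_pos.2 hC
  calc a / √C * √x ≤ a / √C * (√C * d) := by gcongr
    _ = a * d := by field_simp

/-- inequality (4.4) of Lemma 7 of Devroye–Janson.  If `ξ` has span 1,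
then there are `β, δ, c₁ > 0` such that `F` extends analytically to `Δ(β, δ)` with
`|1 - z Φ'(F(z))| ≥ c₁ |1 - z|^{1/2}` on `Δ(β, δ)`. -/
theorem one_sub_zPhiF_lower_bound
    (p : ℕ → ℝ≥0∞) (hp : ∑' k : ℕ, p k = 1)
    (hmean : ∑' k : ℕ, (k : ℝ≥0∞) * p k = 1)
    (hvar_pos : 0 < xiVar p) (hvar_fin : xiVar p ≠ ⊤)
    (hspan : ∀ e : ℕ, (∀ k : ℕ, p k ≠ 0 → e ∣ k) → e ≤ 1) :
    ∃ β δ c₁ : ℝ, 0 < β ∧ β < Real.pi / 2 ∧ 0 < δ ∧ 0 < c₁ ∧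
      ∃ F : ℂ → ℂ, AnalyticOnNhd ℂ F (Metric.ball (0 : ℂ) 1 ∪ Delta β δ) ∧
        (∀ z ∈ Metric.ball (0 : ℂ) 1, F z = Fgen p z) ∧
        ∀ z ∈ Delta β δ,
          c₁ * ‖1 - z‖ ^ ((1 : ℝ) / 2) ≤ ‖1 - z * PhiDeriv p (F z)‖ := by
  have h0 := toReal_apply_zero_pos hp hmean hvar_pos
  obtain ⟨C, hC, hkey⟩ := exists_norm_one_sub_le_mul_sq hp hmean hvar_pos hvar_fin hspan
  obtain ⟨a, ha⟩ : ∃ a, a = 1 - (p 1).toReal := ⟨_, rfl⟩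
  have ha0 : 0 < a := by linarith [toReal_add_toReal_le_one hp zero_ne_one]
  have hFkey : ∀ z : ℂ, ‖z‖ ≤ 1 → ‖1 - z‖ ≤ C * (1 - ‖Fgen p z‖) ^ 2 := fun z hz =>
    hkey z _ hz (norm_Fgen_le_one hp hz) (Fgen_eq_mul_Phi hp hz)
  have hFlt : ∀ z : ℂ, ‖z‖ ≤ 1 → z ≠ 1 → 0 < 1 - ‖Fgen p z‖ := by
    intro z hz hz1
    refine lt_of_le_of_ne (by linarith [norm_Fgen_le_one hp hz]) fun h => hz1 ?_
    have h1 := hFkey z hz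
    rw [← h] at h1
    have h2 : ‖1 - z‖ = 0 := le_antisymm (by simpa using h1) (norm_nonneg _)
    exact (sub_eq_zero.1 (norm_eq_zero.1 h2)).symm
  have hderiv : ∀ {z w : ℂ} {d : ℝ}, ‖w‖ ≤ 1 → ‖z‖ * (1 - a * (1 - ‖w‖)) ≤ 1 - a * d / 4 →
      a / 4 * d ≤ ‖1 - z * PhiDeriv p w‖ := by
    intro z w d hw h
    have h1 := mul_le_mul_of_nonneg_left (norm_PhiDeriv_le hmean hw) (norm_nonneg z)
    rw [← ha, ← norm_mul] at h1
    have h2 := norm_sub_norm_le 1 (z * PhiDeriv p w)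
    rw [norm_one] at h2
    linarith
  have hinner : ∀ z : ℂ, ‖z‖ < 1 → ∃ d, 0 < d ∧ ‖1 - z‖ ≤ 2 * C * d ^ 2 ∧
      IsAttractingSolution p z (Fgen p z) ∧
      ‖z‖ * (1 - a * (1 - ‖Fgen p z‖)) ≤ 1 - a * d / 4 := by
    intro z hz
    have hd := hFlt z hz.le (by rintro rfl; simp at hz)
    have hle : ‖z‖ * (1 - a * (1 - ‖Fgen p z‖)) ≤ 1 - a * (1 - ‖Fgen p z‖) := by
      refine mul_le_of_le_one_left ?_ hz.le
      nlinarith [(p 1).toReal_nonneg, norm_nonneg (Fgen p z)]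
    refine ⟨1 - ‖Fgen p z‖, hd, ?_, ⟨by linarith, Fgen_eq_mul_Phi hp hz.le, ?_⟩, ?_⟩
    · nlinarith [hFkey z hz.le, sq_nonneg (1 - ‖Fgen p z‖)]
    · rw [← ha]
      nlinarith
    · nlinarith
  obtain ⟨β, hβ⟩ : ∃ β, β = min (1 / 4) (a / (32 * C)) := ⟨_, rfl⟩
  have hβ0 : 0 < β := by rw [hβ]; positivity
  have hβ4 : β ≤ 1 / 4 := by rw [hβ]; exact min_le_left _ _
  have hβC : β * (32 * C) ≤ a := by
    rw [← le_div_iff₀ (by positivity), hβ]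
    exact min_le_right _ _
  have hDelta : ∀ z ∈ Delta β (β ^ 2), ∃ d w, 0 < d ∧ ‖1 - z‖ ≤ 2 * C * d ^ 2 ∧
      IsAttractingSolution p z w ∧ ‖z‖ * (1 - a * (1 - ‖w‖)) ≤ 1 - a * d / 4 := by
    intro z hz
    rcases lt_or_ge ‖z‖ 1 with hz1 | hz1
    · obtain ⟨d, h⟩ := hinner z hz1
      exact ⟨d, _, h⟩
    have hgeom := norm_sub_one_le_of_mem_Delta hβ0 hβ4 hz
    have hnz : (‖z‖ : ℂ) ≠ 0 := by
      exact_mod_cast (by linarith : (0 : ℝ) < ‖z‖).ne'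
    obtain ⟨ζ, hζ⟩ : ∃ ζ, ζ = z / ‖z‖ := ⟨_, rfl⟩
    have hζ1 : ‖ζ‖ = 1 := by
      rw [hζ, norm_div, Complex.norm_real, norm_norm, div_self]
      linarith
    have hzζ : ‖z - ζ‖ = ‖z‖ - 1 := by
      have e : z - ζ = ((‖z‖ - 1 : ℝ) : ℂ) * ζ := by
        rw [hζ]
        push_cast
        field_simp
      rw [e, norm_mul, hζ1, mul_one, Complex.norm_real, Real.norm_of_nonneg (by linarith)]
    have hdist : ‖1 - z‖ ≤ 2 * ‖1 - ζ‖ := by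
      have h := norm_sub_le_norm_sub_add_norm_sub 1 ζ z
      rw [norm_sub_rev ζ z, hzζ] at h
      nlinarith [norm_nonneg (1 - z)]
    have hζne : ζ ≠ 1 := by
      rintro h
      rw [h, sub_self, norm_zero, mul_zero] at hdist
      exact hz.2.1 (sub_eq_zero.1 (norm_le_zero_iff.1 hdist)).symm
    obtain ⟨d, hd⟩ : ∃ d, d = 1 - ‖Fgen p ζ‖ := ⟨_, rfl⟩
    have hd0 : 0 < d := hd ▸ hFlt ζ hζ1.le hζne
    have hk : ‖1 - ζ‖ ≤ C * d ^ 2 := hd ▸ hFkey ζ hζ1.le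
    have hsmall : ‖z‖ - 1 ≤ a / 8 * d ^ 2 := by
      have h1 : 2 * β * ‖1 - z‖ ≤ 2 * β * (2 * (C * d ^ 2)) := by
        gcongr
        linarith
      nlinarith [mul_le_mul_of_nonneg_right hβC (sq_nonneg d)]
    obtain ⟨w, hw1, hw2, hw3⟩ := exists_solution_near hp hmean ha ha0 hd hd0
      (Fgen_eq_mul_Phi hp hζ1.le) (by linarith) (hzζ.trans_le hsmall)
    refine ⟨d, w, hd0, by linarith, ⟨hw1, hw2, ?_⟩, hw3⟩
    rw [← ha]
    nlinarith [mul_pos ha0 hd0]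
  refine ⟨β, β ^ 2, a / 4 / √(2 * C), hβ0, by linarith [Real.pi_gt_three], by positivity,
    by positivity, attractingSolution p, ?_, ?_, ?_⟩
  · rintro z (hz | hz)
    · obtain ⟨d, -, -, h, -⟩ := hinner z (mem_ball_zero_iff.1 hz)
      exact h.analyticAt hp hmean h0
    · obtain ⟨d, w, -, -, h, -⟩ := hDelta z hz
      exact h.analyticAt hp hmean h0
  · intro z hz
    obtain ⟨d, -, -, h, -⟩ := hinner z (mem_ball_zero_iff.1 hz)
    exact h.eq hp hmean
  · intro z hz
    obtain ⟨d, w, hd0, hd, h, hw⟩ := hDelta z hz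
    rw [h.eq hp hmean]
    exact mul_rpow_half_le (by positivity) (by positivity) hd0.le hd (hderiv h.1.le hw)
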